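/- Let n ≥ 1, let X, Y, Z be pairwise disjoint finite sets each of size n, let 𝒰 = X ∪ Y ∪ Z, and let 𝒮 be a nonempty finite family of subsets of 𝒰 with |S ∩ X| = |S ∩ Y| = |S ∩ Z| = 1 for each S ∈ 𝒮. Let N consist of a player v_a for each a ∈ 𝒰, a player v_S for each S ∈ 𝒮, and one further player h, and let `beats` be any tournament relation on N satisfying: for every S ∈ 𝒮 and a ∈ 𝒰, v_S beats v_a if a ∈ S and v_a beats v_S if a ∉ S; h beats v_S for every S ∈ 𝒮; and v_a beats h for every a ∈ 𝒰. Define popularities p(h) = 2, p(v_S) = 1 for every S ∈ 𝒮, and p(v_a) = 0 for every a ∈ 𝒰. Then there exists a seeding σ with V_p(σ) ≥ 2|𝒮| + 2n + 1 if and only if there exists 𝒮' ⊆ 𝒮 with |𝒮'| = n such that every element of 𝒰 lies in exactly one member of 𝒮'. -/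

import Mathlib

open Finset

noncomputable section
open scoped Classical

variable {P : Type*}

/-- The list of (winner, loser) pairs of the matches played in a Challenge the Champ
tournament whose current champ is `c` and whose remaining challengers, in order, are
the given list. -/
def ctcMatches (beats : P → P → Prop) : P → List P → List (P × P)
  | _, [] => []
  | c, x :: xs =>
    if beats c x then (c, x) :: ctcMatches beats c xs
    else (x, c) :: ctcMatches beats x xs

/-- The final champ of a Challenge the Champ tournament whose current champ is `c` and
whose remaining challengers, in order, are the given list. -/
def ctcChamp (beats : P → P → Prop) : P → List P → P
  | c, [] => c
  | c, x :: xs => if beats c x then ctcChamp beats c xs else ctcChamp beats x xs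

/-- The (winner, loser) pairs of matches of a Challenge the Champ tournament whose
seeding is given as a list of players. -/
def ctcMatchesL (beats : P → P → Prop) : List P → List (P × P)
  | [] => []
  | c :: xs => ctcMatches beats c xs

/-- The winner of a Challenge the Champ tournament seeded by a list of players. -/
def ctcWinnerL (beats : P → P → Prop) : List P → Option P
  | [] => none
  | c :: xs => some (ctcChamp beats c xs)

/-- The (winner, loser) pairs of the matches played under the seeding `σ`. -/
def matchesOf (beats : P → P → Prop) {n : ℕ} (σ : Fin n → P) : List (P × P) :=
  ctcMatchesL beats (List.ofFn σ)

/-- The winner of the Challenge the Champ tournament under the seeding `σ`. -/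
def winnerOf (beats : P → P → Prop) {n : ℕ} (σ : Fin n → P) : Option P :=
  ctcWinnerL beats (List.ofFn σ)

/-- `M_i(σ)`: the set of players who play a match against `i` and lose it. -/
def Mset [Fintype P] (beats : P → P → Prop) {n : ℕ} (σ : Fin n → P) (i : P) : Finset P :=
  univ.filter fun j => (i, j) ∈ matchesOf beats σ

/-- `w_i(σ)`: the number of matches won by player `i`. -/
def wins [Fintype P] (beats : P → P → Prop) {n : ℕ} (σ : Fin n → P) (i : P) : ℕ :=
  (Mset beats σ i).card

/-- The player-popularity-based tournament value of a seeding: each match contributes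
the popularity of its winner. -/
def Vpop [Fintype P] (beats : P → P → Prop) {n : ℕ} (σ : Fin n → P) (p : P → ℕ) : ℕ :=
  ∑ i, p i * wins beats σ i

section Matches

variable {beats : P → P → Prop}

theorem ctcMatches_mem {c : P} {xs : List P} {i j : P} (h : (i, j) ∈ ctcMatches beats c xs) :
    i ∈ c :: xs ∧ j ∈ c :: xs := by
  induction xs generalizing c with
  | nil => simp [ctcMatches] at h
  | cons x xs ih =>
    rw [ctcMatches] at h
    split_ifs at h <;> rcases List.mem_cons.1 h with h | h
    · simp_all
    · have := ih h
      grind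
    · simp_all
    · have := ih h
      grind

theorem ctcMatches_beats (htot : ∀ i j, i ≠ j → (beats i j ↔ ¬ beats j i)) {c : P} {xs : List P}
    (hnd : (c :: xs).Nodup) {i j : P} (h : (i, j) ∈ ctcMatches beats c xs) : beats i j := by
  induction xs generalizing c with
  | nil => simp [ctcMatches] at h
  | cons x xs ih =>
    rw [ctcMatches] at h
    split_ifs at h with hb <;> rcases List.mem_cons.1 h with h | h
    · simp_all
    · exact ih (by grind) h
    · obtain ⟨rfl, rfl⟩ := Prod.mk.inj h
      exact (htot _ _ (by grind)).2 hb
    · exact ih (by grind) h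

/-- No player plays against itself. -/
theorem ctcMatches_ne {c : P} {xs : List P} (hnd : (c :: xs).Nodup) {i j : P}
    (h : (i, j) ∈ ctcMatches beats c xs) : i ≠ j := by
  induction xs generalizing c with
  | nil => simp [ctcMatches] at h
  | cons x xs ih =>
    rw [ctcMatches] at h
    split_ifs at h with hb <;> rcases List.mem_cons.1 h with h | h
    · grind
    · exact ih (by grind) h
    · grind
    · exact ih (by grind) h

/-- Every player loses at most once. -/
theorem ctcMatches_loser_unique {c : P} {xs : List P} (hnd : (c :: xs).Nodup) {i i' j : P}
    (h : (i, j) ∈ ctcMatches beats c xs) (h' : (i', j) ∈ ctcMatches beats c xs) : i = i' := by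
  induction xs generalizing c with
  | nil => simp [ctcMatches] at h
  | cons x xs ih =>
    rw [ctcMatches] at h h'
    split_ifs at h h' with hb <;> rcases List.mem_cons.1 h with h | h <;>
      rcases List.mem_cons.1 h' with h' | h'
    · grind
    · have := (ctcMatches_mem h').2
      grind
    · have := (ctcMatches_mem h).2
      grind
    · exact ih (by grind) h h'
    · grind
    · have := (ctcMatches_mem h').2
      grind
    · have := (ctcMatches_mem h).2
      grind
    · exact ih (by grind) h h'

/-- The players beaten by the initial champ never win a match. -/
theorem ctcMatches_champ_beaten {c : P} {xs : List P} (hnd : (c :: xs).Nodup) {j k : P}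
    (h : (c, j) ∈ ctcMatches beats c xs) : (j, k) ∉ ctcMatches beats c xs := by
  intro h'
  induction xs generalizing c with
  | nil => simp [ctcMatches] at h
  | cons x xs ih =>
    have hne := ctcMatches_ne hnd h
    rw [ctcMatches] at h h'
    split_ifs at h h' with hb <;> rcases List.mem_cons.1 h with h | h <;>
      rcases List.mem_cons.1 h' with h' | h'
    · grind
    · have := (ctcMatches_mem h').1
      grind
    · grind
    · exact ih (by grind) h h'
    · grind
    · grind
    · have := (ctcMatches_mem h).1
      grind
    · have := (ctcMatches_mem h).1
      grind

theorem ctcMatches_beaten_winner_unique_aux {c : P} {xs : List P} (hnd : (c :: xs).Nodup)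
    {i j j' : P} (h : (i, j) ∈ ctcMatches beats c xs) (h' : (i, j') ∈ ctcMatches beats c xs)
    (hj : j = c ∨ ∃ k, (j, k) ∈ ctcMatches beats c xs)
    (hj' : j' = c ∨ ∃ k, (j', k) ∈ ctcMatches beats c xs) : j = j' := by
  induction xs generalizing c with
  | nil => simp [ctcMatches] at h
  | cons x xs ih =>
    rw [ctcMatches] at h h' hj hj'
    split_ifs at h h' hj hj' with hb
    · have key : ∀ l, (i, l) ∈ (c, x) :: ctcMatches beats c xs →
          (l = c ∨ ∃ k, (l, k) ∈ (c, x) :: ctcMatches beats c xs) →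
          (i, l) ∈ ctcMatches beats c xs ∧ (l = c ∨ ∃ k, (l, k) ∈ ctcMatches beats c xs) := by
        intro l hl hw
        have hx : l ≠ x := by
          rintro rfl
          rcases hw with hw | ⟨k, hw⟩
          · grind
          · rcases List.mem_cons.1 hw with hw | hw
            · grind
            · have := (ctcMatches_mem hw).1
              grind
        grind
      obtain ⟨h1, h2⟩ := key j h hj
      obtain ⟨h3, h4⟩ := key j' h' hj'
      exact ih (by grind) h1 h3 h2 h4
    · have hc : ∀ i, (i, c) ∉ ctcMatches beats x xs := fun i hi => by
        have := (ctcMatches_mem hi).2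
        grind
      have key : ∀ l, (i, l) ∈ (x, c) :: ctcMatches beats x xs → l ≠ c →
          (l = c ∨ ∃ k, (l, k) ∈ (x, c) :: ctcMatches beats x xs) →
          (i, l) ∈ ctcMatches beats x xs ∧ (l = x ∨ ∃ k, (l, k) ∈ ctcMatches beats x xs) := by
        grind
      have mixed : ∀ l, (i, c) ∈ (x, c) :: ctcMatches beats x xs →
          (i, l) ∈ (x, c) :: ctcMatches beats x xs →
          (l = c ∨ ∃ k, (l, k) ∈ (x, c) :: ctcMatches beats x xs) → l = c := by
        intro l h1 h2 h3
        by_contra hl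
        obtain ⟨h4, h5⟩ := key l h2 hl h3
        have hi : i = x := by
          rcases List.mem_cons.1 h1 with h1 | h1
          · grind
          · exact absurd h1 (hc _)
        subst hi
        rcases h5 with rfl | ⟨k, h5⟩
        · exact ctcMatches_ne (by grind) h4 rfl
        · exact ctcMatches_champ_beaten (by grind) h4 h5
      by_cases hjc : j = c
      · subst hjc
        exact (mixed j' h h' hj').symm
      by_cases hjc' : j' = c
      · subst hjc'
        exact mixed j h' h hj
      obtain ⟨h1, h2⟩ := key j h hjc hj
      obtain ⟨h3, h4⟩ := key j' h' hjc' hj'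
      exact ih (by grind) h1 h3 h2 h4

/-- Among the players beaten by a fixed player, at most one wins a match. -/
theorem ctcMatches_beaten_winner_unique {c : P} {xs : List P} (hnd : (c :: xs).Nodup)
    {i j j' k k' : P} (h : (i, j) ∈ ctcMatches beats c xs) (h' : (i, j') ∈ ctcMatches beats c xs)
    (hj : (j, k) ∈ ctcMatches beats c xs) (hj' : (j', k') ∈ ctcMatches beats c xs) : j = j' :=
  ctcMatches_beaten_winner_unique_aux hnd h h' (.inr ⟨k, hj⟩) (.inr ⟨k', hj'⟩)

theorem ctcMatches_nodup {c : P} {xs : List P} (hnd : (c :: xs).Nodup) :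
    (ctcMatches beats c xs).Nodup := by
  induction xs generalizing c with
  | nil => simp [ctcMatches]
  | cons x xs ih =>
    rw [ctcMatches]
    split_ifs with hb <;> refine List.nodup_cons.2 ⟨fun h => ?_, ih (by grind)⟩
    · have := (ctcMatches_mem h).2
      grind
    · have := (ctcMatches_mem h).2
      grind

theorem ctcMatches_append {c : P} {ys zs : List P} (h : ∀ y ∈ ys, beats c y) :
    ctcMatches beats c (ys ++ zs) = ys.map (fun y => (c, y)) ++ ctcMatches beats c zs := by
  induction ys with
  | nil => rfl
  | cons y ys ih => simp_all [ctcMatches]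

theorem Vpop_eq_of_ofFn_eq [Fintype P] {n : ℕ} {σ : Fin n → P} {c : P} {xs : List P}
    (hσ : List.ofFn σ = c :: xs) (p : P → ℕ) : Vpop beats σ p =
      ∑ i, p i * (univ.filter fun j => (i, j) ∈ ctcMatches beats c xs).card := by
  refine Finset.sum_congr rfl fun i _ => ?_
  rw [wins]
  congr 2
  ext j
  simp [Mset, matchesOf, hσ, ctcMatchesL]

theorem sum_mul_card_fiber_eq_sum_map [Fintype P] {M : List (P × P)} (hM : M.Nodup) (p : P → ℕ) :
    ∑ i, p i * (univ.filter fun j => (i, j) ∈ M).card = (M.map fun m => p m.1).sum := by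
  rw [← List.sum_toFinset _ hM, ← Finset.sum_fiberwise (s := M.toFinset) (g := Prod.fst)]
  refine Finset.sum_congr rfl fun i _ => ?_
  have hcard : (univ.filter fun j => (i, j) ∈ M).card = (M.toFinset.filter fun m => m.1 = i).card :=
    Finset.card_bij (fun j _ => (i, j)) (by simp) (by simp) (by
      rintro ⟨a, b⟩ hab
      simp only [mem_filter, List.mem_toFinset] at hab
      obtain ⟨hab, rfl⟩ := hab
      exact ⟨b, by simpa using hab, rfl⟩)
  rw [hcard, mul_comm, ← smul_eq_mul, ← Finset.sum_const]
  exact Finset.sum_congr rfl fun m hm => by rw [(mem_filter.1 hm).2]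

end Matches

/-- Every total relation has a Hamiltonian path. -/
theorem List.exists_perm_isChain {β : Type*} {r : β → β → Prop} (hr : ∀ a b, r a b ∨ r b a)
    (l : List β) : ∃ l' : List β, l'.Perm l ∧ l'.IsChain r := by
  induction l with
  | nil => exact ⟨[], .refl _, .nil⟩
  | cons x l ih =>
    obtain ⟨l', hp, hc⟩ := ih
    suffices H : ∀ m : List β, m.IsChain r → ∃ m' : List β, m'.Perm (x :: m) ∧ m'.IsChain r ∧
        ∀ b ∈ m'.head?, b = x ∨ b ∈ m.head? by
      obtain ⟨m', h1, h2, -⟩ := H l' hc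
      exact ⟨m', h1.trans (hp.cons x), h2⟩
    intro m hm
    induction m with
    | nil => exact ⟨[x], .refl _, .singleton _, by simp⟩
    | cons b m ihm =>
      by_cases hxb : r x b
      · exact ⟨x :: b :: m, .refl _, .cons_cons hxb hm, by simp⟩
      · obtain ⟨m', h1, h2, h3⟩ := ihm hm.tail
        refine ⟨b :: m', (h1.cons b).trans (.swap _ _ _), ?_, by simp⟩
        rw [List.isChain_cons] at hm ⊢
        refine ⟨fun y hy => ?_, h2⟩
        rcases h3 y hy with rfl | hy
        · exact (hr b y).resolve_right hxb
        · exact hm.1 y hy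

section Reduction

variable {A B : Type*}

/-- The popularities of the reduction. -/
def reductionPop : A ⊕ (B ⊕ Unit) → ℕ :=
  Sum.elim (fun _ => 0) (Sum.elim (fun _ => 1) (fun _ => 2))

@[simp]
theorem reductionPop_inl (a : A) : reductionPop (.inl a : A ⊕ (B ⊕ Unit)) = 0 := rfl

@[simp]
theorem reductionPop_inr_inl (b : B) : reductionPop (.inr (.inl b) : A ⊕ (B ⊕ Unit)) = 1 := rfl

@[simp]
theorem reductionPop_inr_inr (u : Unit) : reductionPop (.inr (.inr u) : A ⊕ (B ⊕ Unit)) = 2 := rfl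

variable {beats : A ⊕ (B ⊕ Unit) → A ⊕ (B ⊕ Unit) → Prop}

/-- The seeding that lists the given sets in order, each set followed by its elements. -/
def coverSeeding (E : B → Finset A) (l : List B) : List (A ⊕ (B ⊕ Unit)) :=
  l.flatMap fun b => .inr (.inl b) :: (E b).toList.map .inl

theorem length_coverSeeding {E : B → Finset A} (hE : ∀ b, (E b).card = 3) (l : List B) :
    (coverSeeding E l).length = 4 * l.length := by
  induction l with
  | nil => rfl
  | cons b l ih =>
    simp only [coverSeeding] at ih
    simp [coverSeeding, hE, ih]
    ring

theorem value_coverSeeding {E : B → Finset A} (hE : ∀ b, (E b).card = 3)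
    (htot : ∀ i j, i ≠ j → (beats i j ↔ ¬ beats j i))
    (hBA : ∀ b, ∀ a ∈ E b, beats (.inr (.inl b)) (.inl a))
    (hhB : ∀ b, beats (.inr (.inr ())) (.inr (.inl b))) (rest : List B) (b : B) (l : List B)
    (hnd : (b :: l).Nodup)
    (hl : (b :: l).IsChain fun s t => s = t ∨ beats (.inr (.inl t)) (.inr (.inl s))) :
    ((ctcMatches beats (.inr (.inl b)) ((E b).toList.map .inl ++ (coverSeeding E l ++
      .inr (.inr ()) :: rest.map fun r => .inr (.inl r)))).map fun m => reductionPop m.1).sum =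
      4 * l.length + 5 + 2 * rest.length := by
  induction l generalizing b with
  | nil =>
    have hb : ¬ beats (.inr (.inl b)) (.inr (.inr ())) :=
      (htot _ _ (by simp)).1 (hhB b)
    have hrest := ctcMatches_append (beats := beats) (c := .inr (.inr ())) (zs := [])
      (ys := rest.map fun r => .inr (.inl r)) (by simpa using fun r _ => hhB r)
    rw [List.append_nil] at hrest
    rw [ctcMatches_append (by simpa using hBA b)]
    simp [coverSeeding, ctcMatches, hb, hrest, Function.comp_def, hE]
    ring
  | cons t l ih =>
    have hbt : beats (.inr (.inl t)) (.inr (.inl b)) :=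
      (List.isChain_cons_cons.1 hl).1.resolve_left (by grind)
    have hbt' : ¬ beats (.inr (.inl b)) (.inr (.inl t)) := (htot _ _ (by grind)).1 hbt
    have := ih t (by grind) (List.isChain_cons_cons.1 hl).2
    rw [ctcMatches_append (by simpa using hBA b)]
    simp only [coverSeeding, List.flatMap_cons, List.cons_append, List.append_assoc] at this ⊢
    simp [ctcMatches, hbt', this, Function.comp_def, hE]
    ring

theorem exists_equiv_ofFn_eq [Fintype P] {L : List P} (hmem : ∀ x, x ∈ L)
    (hlen : L.length = Fintype.card P) :
    ∃ σ : Fin (Fintype.card P) ≃ P, List.ofFn σ = L := by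
  have hnd : L.Nodup := by
    have h : L.toFinset = univ := by
      ext x
      simp [hmem]
    rw [← Multiset.coe_nodup, ← Multiset.toFinset_card_eq_card_iff_nodup]
    change L.toFinset.card = L.length
    rw [h, hlen, Finset.card_univ]
  rw [← hlen]
  refine ⟨hnd.getEquivOfForallMemList L hmem, ?_⟩
  exact List.ofFn_get L

variable [Fintype A] [Fintype B]

theorem sum_card_filter_eq_of_unique {ι κ : Type*} [Fintype ι] [Fintype κ] (R : ι → κ → Prop)
    (hR : ∀ i i' j, R i j → R i' j → i = i') :
    ∑ i, (univ.filter fun j => R i j).card = (univ.filter fun j => ∃ i, R i j).card := by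
  rw [← Finset.card_biUnion]
  · congr 1
    ext
    simp
  · intro i _ i' _ hne
    rw [Function.onFun, Finset.disjoint_left]
    intro j hj hj'
    exact hne (hR _ _ _ (mem_filter.1 hj).2 (mem_filter.1 hj').2)

/-- If the matches `R` are worth enough, the family of players of popularity one that beat some
player of popularity zero is an exact cover. -/
theorem exists_exactCover_of_value {n : ℕ} (hA : Fintype.card A = 3 * n) (E : B → Finset A)
    (hE : ∀ b, (E b).card = 3) (R : A ⊕ (B ⊕ Unit) → A ⊕ (B ⊕ Unit) → Prop)
    (hBA : ∀ b a, R (.inr (.inl b)) (.inl a) → a ∈ E b)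
    (hBh : ∀ b, ¬ R (.inr (.inl b)) (.inr (.inr ())))
    (hhA : ∀ a, ¬ R (.inr (.inr ())) (.inl a))
    (hhh : ¬ R (.inr (.inr ())) (.inr (.inr ())))
    (huniq : ∀ i i' j, R i j → R i' j → i = i')
    (hwin : ∀ i j j' k k', R i j → R i j' → R j k → R j' k' → j = j')
    (hval : 2 * Fintype.card B + 2 * n + 1 ≤
      ∑ i, reductionPop i * (univ.filter fun j => R i j).card) :
    ∃ T : Finset B, T.card = n ∧ ∀ a, ∃! b, b ∈ T ∧ a ∈ E b := by
  have hcard : ∀ i, (univ.filter fun j => R i j).card =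
      (univ.filter fun a => R i (.inl a)).card +
      ((univ.filter fun b => R i (.inr (.inl b))).card + if R i (.inr (.inr ())) then 1 else 0) := by
    intro i
    simp only [Finset.card_filter, Fintype.sum_sum_type, Finset.univ_unique,
      Finset.sum_singleton, PUnit.default_eq_unit]
  set w : B → ℕ := fun b => (univ.filter fun a => R (.inr (.inl b)) (.inl a)).card with hw
  set T : Finset B := univ.filter fun b => ∃ a, R (.inr (.inl b)) (.inl a) with hT
  set C : Finset B := univ.filter fun b' => ∃ b, R (.inr (.inl b)) (.inr (.inl b')) with hC
  set D : Finset B := univ.filter fun b' => R (.inr (.inr ())) (.inr (.inl b')) with hD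
  have hsumC : ∑ b, (univ.filter fun b' => R (.inr (.inl b)) (.inr (.inl b'))).card = C.card :=
    sum_card_filter_eq_of_unique (fun b b' => R (.inr (.inl b)) (.inr (.inl b')))
      fun b b' j h h' => by simpa using huniq _ _ _ h h'
  have hsumw : ∑ b, w b = (univ.filter fun a => ∃ b, R (.inr (.inl b)) (.inl a)).card :=
    sum_card_filter_eq_of_unique (fun b a => R (.inr (.inl b)) (.inl a))
      fun b b' j h h' => by simpa using huniq _ _ _ h h'
  have hval' : 2 * Fintype.card B + 2 * n + 1 ≤ (∑ b, w b) + C.card + 2 * D.card := by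
    refine hval.trans (le_of_eq ?_)
    simp only [hcard]
    rw [Fintype.sum_sum_type, Fintype.sum_sum_type]
    simp [hBh, hhA, hhh, Finset.sum_add_distrib, hsumC, hw, hD]
  have hCD : C.card + D.card ≤ Fintype.card B := by
    rw [← Finset.card_union_of_disjoint]
    · exact Finset.card_le_univ _
    · rw [Finset.disjoint_left]
      intro b hb hb'
      obtain ⟨b', hb⟩ := (mem_filter.1 hb).2
      simpa using huniq _ _ _ hb (mem_filter.1 hb').2
  have hDT : (D ∩ T).card ≤ 1 := by
    refine Finset.card_le_one.2 fun b hb b' hb' => ?_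
    simp only [hD, hT, mem_inter, mem_filter, mem_univ, true_and] at hb hb'
    obtain ⟨h1, a, h2⟩ := hb
    obtain ⟨h3, a', h4⟩ := hb'
    simpa using hwin _ _ _ _ _ h1 h3 h2 h4
  have hDT' : D.card + T.card ≤ Fintype.card B + 1 := by
    have h1 := Finset.card_union_add_card_inter D T
    have h2 := Finset.card_le_univ (D ∪ T)
    omega
  have hsub : ∀ b, (univ.filter fun a => R (.inr (.inl b)) (.inl a)) ⊆ E b := fun b a ha =>
    hBA b a (mem_filter.1 ha).2
  have hw3 : ∀ b, w b ≤ 3 := fun b => (Finset.card_le_card (hsub b)).trans (hE b).le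
  have hwT : ∑ b, w b = ∑ b ∈ T, w b := by
    refine (Finset.sum_subset (Finset.subset_univ T) fun b _ hb => ?_).symm
    refine Finset.card_eq_zero.2 (Finset.filter_eq_empty_iff.2 fun a _ h => hb ?_)
    exact mem_filter.2 ⟨mem_univ _, a, h⟩
  have hle3 : ∑ b ∈ T, w b ≤ 3 * T.card := by
    rw [mul_comm, ← smul_eq_mul]
    exact Finset.sum_le_card_nsmul _ _ _ fun b _ => hw3 b
  have hlen : ∑ b, w b ≤ 3 * n := by
    rw [hsumw, ← hA]
    exact Finset.card_le_univ _
  have hTn : T.card = n := by omega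
  have hsum : ∑ b, w b = 3 * n := by omega
  have hfull : ∀ b ∈ T, w b = 3 := by
    have : ∑ b ∈ T, w b = ∑ b ∈ T, 3 := by
      rw [Finset.sum_const, smul_eq_mul]
      omega
    exact (Finset.sum_eq_sum_iff_of_le fun b _ => hw3 b).1 this
  have hall : ∀ b ∈ T, ∀ a ∈ E b, R (.inr (.inl b)) (.inl a) := by
    intro b hb a ha
    have := Finset.eq_of_subset_of_card_le (hsub b) ((hE b).trans (hfull b hb).symm).le
    rw [← this] at ha
    exact (mem_filter.1 ha).2
  have hcover : ∀ a, ∃ b, R (.inr (.inl b)) (.inl a) := by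
    have : (univ.filter fun a => ∃ b, R (.inr (.inl b)) (.inl a)) = univ := by
      rw [← Finset.card_eq_iff_eq_univ]
      omega
    intro a
    have ha : a ∈ univ.filter fun a => ∃ b, R (.inr (.inl b)) (.inl a) := by
      rw [this]
      exact mem_univ a
    exact (mem_filter.1 ha).2
  refine ⟨T, hTn, fun a => ?_⟩
  obtain ⟨b, hb⟩ := hcover a
  refine ⟨b, ⟨mem_filter.2 ⟨mem_univ _, a, hb⟩, hBA _ _ hb⟩, ?_⟩
  rintro b' ⟨hb', ha⟩
  simpa using huniq _ _ _ (hall b' hb' a ha) hb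

theorem exists_seeding_iff_exactCover {n : ℕ} (hn : 1 ≤ n) (hA : Fintype.card A = 3 * n)
    (E : B → Finset A) (hE : ∀ b, (E b).card = 3)
    (htot : ∀ i j, i ≠ j → (beats i j ↔ ¬ beats j i))
    (hBA : ∀ b a, beats (.inr (.inl b)) (.inl a) ↔ a ∈ E b)
    (hhB : ∀ b, beats (.inr (.inr ())) (.inr (.inl b)))
    (hAh : ∀ a, beats (.inl a) (.inr (.inr ()))) :
    (∃ σ : Fin (Fintype.card (A ⊕ (B ⊕ Unit))) ≃ A ⊕ (B ⊕ Unit),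
      2 * Fintype.card B + 2 * n + 1 ≤ Vpop beats σ reductionPop) ↔
    ∃ T : Finset B, T.card = n ∧ ∀ a, ∃! b, b ∈ T ∧ a ∈ E b := by
  constructor
  · rintro ⟨σ, hσ⟩
    have hnd : (List.ofFn σ).Nodup := List.nodup_ofFn.2 σ.injective
    cases hL : List.ofFn σ with
    | nil =>
      have := congrArg List.length hL
      simp at this
    | cons c xs =>
      rw [Vpop_eq_of_ofFn_eq hL] at hσ
      rw [hL] at hnd
      refine exists_exactCover_of_value hA E hE (fun i j => (i, j) ∈ ctcMatches beats c xs)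
        (fun b a h => (hBA b a).1 (ctcMatches_beats htot hnd h))
        (fun b h => (htot _ _ (by simp)).1 (ctcMatches_beats htot hnd h) (hhB b))
        (fun a h => (htot _ _ (by simp)).1 (ctcMatches_beats htot hnd h) (hAh a))
        (fun h => ctcMatches_ne hnd h rfl)
        (fun i i' j => ctcMatches_loser_unique hnd)
        (fun i j j' k k' => ctcMatches_beaten_winner_unique hnd) (by convert hσ)
  · rintro ⟨T, hT, hcov⟩
    obtain ⟨l, hp, hl⟩ := List.exists_perm_isChain
      (r := fun s t : B => s = t ∨ beats (.inr (.inl t)) (.inr (.inl s)))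
      (fun s t => by
        by_cases h : s = t
        · exact .inl (.inl h)
        · have := htot (.inr (.inl s)) (.inr (.inl t)) (by simpa using h)
          tauto) T.toList
    have hlen : l.length = n := by rw [hp.length_eq, Finset.length_toList, hT]
    have hnd : l.Nodup := hp.nodup_iff.2 T.nodup_toList
    have hmem : ∀ b, b ∈ l ↔ b ∈ T := fun b => by rw [hp.mem_iff, Finset.mem_toList]
    have hrest : Tᶜ.toList.length + n = Fintype.card B := by
      rw [Finset.length_toList, ← hT, Finset.card_compl_add_card]
    obtain ⟨σ, hσ⟩ := exists_equiv_ofFn_eq (L := coverSeeding E l ++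
        .inr (.inr ()) :: Tᶜ.toList.map fun r => .inr (.inl r))
      (by
        rintro (a | b | -)
        · obtain ⟨b, ⟨hb, ha⟩, -⟩ := hcov a
          simp only [coverSeeding, List.mem_append, List.mem_flatMap]
          exact .inl ⟨b, (hmem b).2 hb, by simpa using ha⟩
        · by_cases hb : b ∈ T
          · simp only [coverSeeding, List.mem_append, List.mem_flatMap]
            exact .inl ⟨b, (hmem b).2 hb, by simp⟩
          · simp [hb]
        · simp)
      (by
        rw [List.length_append, length_coverSeeding hE]
        simp only [List.length_cons, List.length_map, Fintype.card_sum, Fintype.card_unit]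
        omega)
    refine ⟨σ, ?_⟩
    have hσnd : (List.ofFn σ).Nodup := List.nodup_ofFn.2 σ.injective
    rw [hσ] at hσnd
    cases l with
    | nil => simp at hlen; omega
    | cons b l =>
      have hval := value_coverSeeding hE htot (fun b a => (hBA b a).2) hhB Tᶜ.toList b l hnd hl
      simp only [coverSeeding, List.flatMap_cons, List.cons_append, List.append_assoc]
        at hσ hσnd hval
      rw [Vpop_eq_of_ofFn_eq hσ, sum_mul_card_fiber_eq_sum_map (ctcMatches_nodup hσnd), hval]
      simp only [List.length_cons] at hlen
      omega

end Reduction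

/-- Hardness reduction for player-popularity values in `{0,1,2}`: given a
3-Dimensional Matching instance (`X`, `Y`, `Z` pairwise disjoint of size `n`,
`𝒰 = X ∪ Y ∪ Z`, and a nonempty family `𝒮` of subsets of `𝒰` meeting each of
`X`, `Y`, `Z` in exactly one element), take a player `v_a` for each `a ∈ 𝒰`
(popularity 0), a player `v_S` for each `S ∈ 𝒮` (popularity 1), and one further
player `h` (popularity 2); `v_S` beats `v_a` iff `a ∈ S`, `h` beats every `v_S`,
and every `v_a` beats `h`.  Then some seeding attains value at least
`2|𝒮| + 2n + 1` iff the instance has a perfect 3-dimensional matching. -/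
theorem ctc_popularity_012_reduction {α : Type*} [DecidableEq α]
    (n : ℕ) (hn : 1 ≤ n) (X Y Z : Finset α)
    (hXY : Disjoint X Y) (hXZ : Disjoint X Z) (hYZ : Disjoint Y Z)
    (hX : X.card = n) (hY : Y.card = n) (hZ : Z.card = n)
    (U : Finset α) (hU : U = X ∪ Y ∪ Z)
    (S : Finset (Finset α)) (hSne : S.Nonempty)
    (hS : ∀ s ∈ S, s ⊆ U ∧ (s ∩ X).card = 1 ∧ (s ∩ Y).card = 1 ∧ (s ∩ Z).card = 1)
    (beats : ({a // a ∈ U} ⊕ ({s // s ∈ S} ⊕ Unit)) →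
             ({a // a ∈ U} ⊕ ({s // s ∈ S} ⊕ Unit)) → Prop)
    (hirr : ∀ i, ¬ beats i i)
    (htot : ∀ i j, i ≠ j → (beats i j ↔ ¬ beats j i))
    (hSa : ∀ (s : {s // s ∈ S}) (a : {a // a ∈ U}),
      ((a : α) ∈ (s : Finset α) → beats (Sum.inr (Sum.inl s)) (Sum.inl a)) ∧
      ((a : α) ∉ (s : Finset α) → beats (Sum.inl a) (Sum.inr (Sum.inl s))))
    (hhS : ∀ s : {s // s ∈ S}, beats (Sum.inr (Sum.inr ())) (Sum.inr (Sum.inl s)))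
    (hah : ∀ a : {a // a ∈ U}, beats (Sum.inl a) (Sum.inr (Sum.inr ()))) :
    (∃ σ : Fin (Fintype.card ({a // a ∈ U} ⊕ ({s // s ∈ S} ⊕ Unit))) ≃
        ({a // a ∈ U} ⊕ ({s // s ∈ S} ⊕ Unit)),
      2 * S.card + 2 * n + 1 ≤
        Vpop beats (⇑σ) (Sum.elim (fun _ => 0) (Sum.elim (fun _ => 1) (fun _ => 2)))) ↔
    (∃ S' ⊆ S, S'.card = n ∧ ∀ a ∈ U, ∃! s, s ∈ S' ∧ a ∈ s) := by
  have hUcard : U.card = 3 * n := by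
    rw [hU, Finset.card_union_of_disjoint (Finset.disjoint_union_left.2 ⟨hXZ, hYZ⟩),
      Finset.card_union_of_disjoint hXY]
    omega
  have hcard : ∀ s ∈ S, s.card = 3 := by
    intro s hs
    obtain ⟨hsU, h1, h2, h3⟩ := hS s hs
    have : s = s ∩ X ∪ s ∩ Y ∪ s ∩ Z := by
      rw [← Finset.inter_union_distrib_left, ← Finset.inter_union_distrib_left, ← hU,
        Finset.inter_eq_left.2 hsU]
    rw [this, Finset.card_union_of_disjoint, Finset.card_union_of_disjoint, h1, h2, h3]
    · exact hXY.mono Finset.inter_subset_right Finset.inter_subset_right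
    · exact (Finset.disjoint_union_left.2 ⟨hXZ, hYZ⟩).mono
        (Finset.union_subset_union Finset.inter_subset_right Finset.inter_subset_right)
        Finset.inter_subset_right
  have key := exists_seeding_iff_exactCover (A := {a // a ∈ U}) (B := {s // s ∈ S})
    (beats := beats) hn (by simpa using hUcard) (fun s => (s : Finset α).subtype (· ∈ U))
    (fun s => by
      rw [Finset.card_subtype, Finset.filter_true_of_mem fun a ha => (hS s s.2).1 ha]
      exact hcard s s.2)
    htot
    (fun s a => by
      have h1 := hSa s a
      have h2 := htot (.inl a) (.inr (.inl s)) (by simp)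
      rw [Finset.mem_subtype]
      tauto)
    hhS hah
  rw [Fintype.card_coe] at key
  refine key.trans ⟨?_, ?_⟩
  · rintro ⟨T, hT, hcov⟩
    refine ⟨T.map (Function.Embedding.subtype _), Finset.map_subtype_subset T,
      by rw [Finset.card_map, hT], fun a ha => ?_⟩
    obtain ⟨b, ⟨hb, hab⟩, huniq⟩ := hcov ⟨a, ha⟩
    rw [Finset.mem_subtype] at hab
    refine ⟨b, ⟨Finset.mem_map.2 ⟨b, hb, rfl⟩, hab⟩, ?_⟩
    rintro s ⟨hs, has⟩
    obtain ⟨t, ht, rfl⟩ := Finset.mem_map.1 hs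
    exact congrArg Subtype.val (huniq t ⟨ht, Finset.mem_subtype.2 has⟩)
  · rintro ⟨S', hS', hcardS', hcov⟩
    refine ⟨S'.subtype (· ∈ S), ?_, fun a => ?_⟩
    · rw [Finset.card_subtype, Finset.filter_true_of_mem fun s hs => hS' hs, hcardS']
    · obtain ⟨s, ⟨hs, has⟩, huniq⟩ := hcov a a.2
      refine ⟨⟨s, hS' hs⟩, ⟨Finset.mem_subtype.2 hs, Finset.mem_subtype.2 has⟩, ?_⟩
      rintro t ⟨ht, hat⟩
      exact Subtype.ext (huniq t ⟨Finset.mem_subtype.1 ht, Finset.mem_subtype.1 hat⟩)
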